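/- Let T and T′ be locally finite triangulations of the ∞-gon. Then there exists a T-admissible sequence θ with μ_θ(T) = T′. -/

import Mathlib

open scoped Classical

/-- An arc of the ∞-gon: a pair of integers `(i,j)` with `i ≤ j − 2`. -/
structure ArcZ where
  src : ℤ
  tgt : ℤ
  sep : src + 2 ≤ tgt

/-- Two arcs `(i,j)` and `(k,l)` cross if `i < k < j < l` or `k < i < l < j`. -/
def CrossZ (x y : ArcZ) : Prop :=
  (x.src < y.src ∧ y.src < x.tgt ∧ x.tgt < y.tgt) ∨
  (y.src < x.src ∧ x.src < y.tgt ∧ y.tgt < x.tgt)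

/-- A triangulation of the ∞-gon: a maximal set of pairwise compatible
(= non-crossing) arcs. -/
def IsTriangulationZ (T : Set ArcZ) : Prop :=
  (∀ x ∈ T, ∀ y ∈ T, ¬ CrossZ x y) ∧
  ∀ γ : ArcZ, (∀ x ∈ T, ¬ CrossZ γ x) → γ ∈ T

/-- `T` has a right fountain at `n`. -/
def RightFountainZ (T : Set ArcZ) (n : ℤ) : Prop :=
  {p : ℤ | ∃ γ ∈ T, γ.src = n ∧ γ.tgt = p}.Infinite

/-- `T` has a left fountain at `n`. -/
def LeftFountainZ (T : Set ArcZ) (n : ℤ) : Prop :=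
  {p : ℤ | ∃ γ ∈ T, γ.src = p ∧ γ.tgt = n}.Infinite

/-- `T` is locally finite if every integer is an endpoint of only finitely many arcs of `T`. -/
def LocallyFinZ (T : Set ArcZ) : Prop :=
  ∀ v : ℤ, {γ | γ ∈ T ∧ (γ.src = v ∨ γ.tgt = v)}.Finite

/-- `γ'` is an exchange partner for `γ` relative to `T`:
it is distinct from `γ` and `(T \ {γ}) ∪ {γ'}` is again a triangulation. -/
def MutExchangeZ (T : Set ArcZ) (γ γ' : ArcZ) : Prop :=
  γ' ≠ γ ∧ IsTriangulationZ ((T \ {γ}) ∪ {γ'})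

/-- `γ` is a mutable arc of `T`. -/
def IsMutableZ (T : Set ArcZ) (γ : ArcZ) : Prop :=
  γ ∈ T ∧ ∃ γ', MutExchangeZ T γ γ'

/-- The (unique) replacement arc of `γ` in `T`, when `γ` is mutable. -/
noncomputable def flipArcZ (T : Set ArcZ) (γ : ArcZ) : ArcZ :=
  if h : ∃ γ', MutExchangeZ T γ γ' then h.choose else γ

/-- The mutation `μ_γ(T)` of `T` at `γ`. -/
noncomputable def mutateZ (T : Set ArcZ) (γ : ArcZ) : Set ArcZ :=
  (T \ {γ}) ∪ {flipArcZ T γ}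

/-- `μ_γ(δ)`: the effect of the mutation of `T` at `γ` on the arc `δ`. -/
noncomputable def mutArcZ (T : Set ArcZ) (γ δ : ArcZ) : ArcZ :=
  if δ = γ then flipArcZ T γ else δ

/-- One step of a mutation sequence on a set of arcs (`none` = no entry). -/
noncomputable def stepTZ (T : Set ArcZ) : Option ArcZ → Set ArcZ
  | none => T
  | some γ => mutateZ T γ

/-- One step of a mutation sequence on a single arc. -/
noncomputable def stepAZ (T : Set ArcZ) : Option ArcZ → ArcZ → ArcZ
  | none, δ => δ
  | some γ, δ => mutArcZ T γ δ

/-- `iterTZ T θ k` is `μ_{θ_k} ∘ ⋯ ∘ μ_{θ_1}(T)`. Sequences (finite or infinite) are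
encoded as `θ : ℕ → Option ArcZ` whose support is downward closed. -/
noncomputable def iterTZ (T : Set ArcZ) (θ : ℕ → Option ArcZ) : ℕ → Set ArcZ
  | 0 => T
  | k + 1 => stepTZ (iterTZ T θ k) (θ k)

/-- `iterAZ T θ γ k` is `μ_{θ_k} ∘ ⋯ ∘ μ_{θ_1}(γ)`. -/
noncomputable def iterAZ (T : Set ArcZ) (θ : ℕ → Option ArcZ) (γ : ArcZ) : ℕ → ArcZ
  | 0 => γ
  | k + 1 => stepAZ (iterTZ T θ k) (θ k) (iterAZ T θ γ k)

/-- `θ` is a `T`-admissible sequence: its support is downward closed (so it is a genuine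
finite or infinite sequence), each entry is mutable in the triangulation obtained by the
previous mutations, and the mutation of each arc of `T` along `θ` eventually stabilizes. -/
def AdmissibleZ (T : Set ArcZ) (θ : ℕ → Option ArcZ) : Prop :=
  (∀ i, θ i = none → θ (i + 1) = none) ∧
  (∀ i γ, θ i = some γ → IsMutableZ (iterTZ T θ i) γ) ∧
  (∀ γ ∈ T, ∃ l, ∀ k, l ≤ k → iterAZ T θ γ k = iterAZ T θ γ l)

/-- `μ_θ(γ)`: the stable value of the mutation of the arc `γ` along the sequence `θ`. -/
noncomputable def seqLimitZ (T : Set ArcZ) (θ : ℕ → Option ArcZ) (γ : ArcZ) : ArcZ :=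
  if h : ∃ l, ∀ k, l ≤ k → iterAZ T θ γ k = iterAZ T θ γ l
  then iterAZ T θ γ h.choose else γ

/-- `μ_θ(T)`: the mutation of `T` along the sequence `θ`. -/
noncomputable def mutSeqZ (T : Set ArcZ) (θ : ℕ → Option ArcZ) : Set ArcZ :=
  seqLimitZ T θ '' T

/-- The sequence `θ` leaves the arc `γ` untouched. -/
def UntouchedZ (T : Set ArcZ) (θ : ℕ → Option ArcZ) (γ : ArcZ) : Prop :=
  ∀ l, iterAZ T θ γ l = γ

/-- The quadrilateral `S(γ)` of a mutable arc `γ` in `T`: with `v₁ < v₂ < v₃ < v₄` the four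
endpoints of the two diagonals `γ` and `flipArcZ T γ`, it consists of those of the pairs
`(v₁,v₂), (v₂,v₃), (v₃,v₄), (v₁,v₄)` that are arcs. -/
noncomputable def quadZ (T : Set ArcZ) (γ : ArcZ) : Set ArcZ :=
  let γ' := flipArcZ T γ
  let vs : ℤ × ℤ × ℤ × ℤ :=
    if γ.src < γ'.src then (γ.src, γ'.src, γ.tgt, γ'.tgt) else (γ'.src, γ.src, γ'.tgt, γ.tgt)
  {δ : ArcZ | (δ.src = vs.1 ∧ δ.tgt = vs.2.1) ∨ (δ.src = vs.2.1 ∧ δ.tgt = vs.2.2.1) ∨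
    (δ.src = vs.2.2.1 ∧ δ.tgt = vs.2.2.2) ∨ (δ.src = vs.1 ∧ δ.tgt = vs.2.2.2)}

/-- The restriction `T|_S` of a set of arcs to a set `S` of vertices. -/
def restrictZ (T : Set ArcZ) (S : Set ℤ) : Set ArcZ :=
  {γ | γ ∈ T ∧ γ.src ∈ S ∧ γ.tgt ∈ S}

/-- `T ≤_s T'`: there is a `T`-admissible sequence `θ` with `μ_θ(T) = T'`. -/
def leS (T T' : Set ArcZ) : Prop :=
  ∃ θ : ℕ → Option ArcZ, AdmissibleZ T θ ∧ mutSeqZ T θ = T'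

/-- `a < b` are joined by an arc of `S` or by a boundary edge. -/
def EdgeZ (S : Set ArcZ) (a b : ℤ) : Prop :=
  b = a + 1 ∨ ∃ γ ∈ S, γ.src = a ∧ γ.tgt = b

theorem EdgeZ.lt {S : Set ArcZ} {a b : ℤ} (h : EdgeZ S a b) : a < b := by
  rcases h with h | ⟨γ, _, h1, h2⟩
  · omega
  · have := γ.sep; omega

theorem EdgeZ.nc {S : Set ArcZ} {a b : ℤ} (h : EdgeZ S a b) (χ : ArcZ)
    (hχ : ∀ s ∈ S, s.src = a → s.tgt = b → ¬ CrossZ χ s) :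
    ¬ (a < χ.src ∧ χ.src < b ∧ b < χ.tgt) ∧ ¬ (χ.src < a ∧ a < χ.tgt ∧ χ.tgt < b) := by
  rcases h with h | ⟨γ, hγ, h1, h2⟩
  · constructor <;> omega
  · have := hχ γ hγ h1 h2
    unfold CrossZ at this
    subst h1 h2
    constructor <;> intro h <;> apply this <;> omega

theorem EdgeZ.nc' {S : Set ArcZ} (hS : IsTriangulationZ S) {a b : ℤ} (h : EdgeZ S a b)
    {χ : ArcZ} (hχ : χ ∈ S) :
    ¬ (a < χ.src ∧ χ.src < b ∧ b < χ.tgt) ∧ ¬ (χ.src < a ∧ a < χ.tgt ∧ χ.tgt < b) :=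
  h.nc χ (fun s hs _ _ => hS.1 χ hχ s hs)

theorem EdgeZ.of_nc {S : Set ArcZ} (hS : IsTriangulationZ S) {a b : ℤ} (hab : a < b)
    (h : ∀ s ∈ S, ¬ (a < s.src ∧ s.src < b ∧ b < s.tgt) ∧
      ¬ (s.src < a ∧ a < s.tgt ∧ s.tgt < b)) : EdgeZ S a b := by
  by_cases h1 : b = a + 1
  · exact Or.inl h1
  · refine Or.inr ⟨⟨a, b, by omega⟩, hS.2 _ ?_, rfl, rfl⟩
    intro s hs hc
    have := h s hs
    unfold CrossZ at hc
    simp only at hc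
    omega

theorem EdgeZ.arc {S : Set ArcZ} {a b : ℤ} (h : EdgeZ S a b) (hab : a + 2 ≤ b) :
    ∃ γ ∈ S, γ.src = a ∧ γ.tgt = b := by
  rcases h with h | h
  · omega
  · exact h

theorem edge_of_mem {S : Set ArcZ} {γ : ArcZ} (h : γ ∈ S) : EdgeZ S γ.src γ.tgt :=
  Or.inr ⟨γ, h, rfl, rfl⟩

theorem exists_max_int (P : ℤ → Prop) (B : ℤ) (hB : ∀ z, P z → z ≤ B) (hne : ∃ z, P z) :
    ∃ m, P m ∧ ∀ z, P z → z ≤ m :=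
  Int.exists_greatest_of_bdd ⟨B, hB⟩ hne

theorem lower_apex {S : Set ArcZ} (hS : IsTriangulationZ S) {γ : ArcZ} (hγ : γ ∈ S) :
    ∃ v, γ.src < v ∧ v < γ.tgt ∧ EdgeZ S γ.src v ∧ EdgeZ S v γ.tgt := by
  have hsep := γ.sep
  obtain ⟨k, ⟨hk1, hk2⟩, hmax⟩ := exists_max_int (fun k => k < γ.tgt ∧ EdgeZ S γ.src k) γ.tgt
    (fun z hz => hz.1.le) ⟨γ.src + 1, by omega, Or.inl rfl⟩
  refine ⟨k, hk2.lt, hk1, hk2, EdgeZ.of_nc hS hk1 ?_⟩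
  intro s hs
  have h1 := (edge_of_mem hγ).nc' hS hs
  have h2 := hk2.nc' hS hs
  have h3 := hk2.lt
  have h4 : s.src = γ.src → s.tgt < γ.tgt → s.tgt ≤ k := fun h h' =>
    hmax _ ⟨h', h ▸ edge_of_mem hs⟩
  omega

theorem exists_over {S : Set ArcZ} (hS : IsTriangulationZ S) (hlf : LocallyFinZ S)
    {γ : ArcZ} (hγ : γ ∈ S) :
    ∃ δ ∈ S, δ.src ≤ γ.src ∧ γ.tgt ≤ δ.tgt ∧ (δ.src < γ.src ∨ γ.tgt < δ.tgt) := by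
  by_contra! hcon
  have hsep := γ.sep
  have hfin := (hlf γ.tgt).image ArcZ.tgt
  obtain ⟨B, hB⟩ := hfin.bddAbove
  obtain ⟨m, hm, hmax⟩ := exists_max_int (fun k => EdgeZ S γ.tgt k) (max B (γ.tgt + 1))
    (by
      rintro z (h | ⟨δ, hδ, h1, h2⟩)
      · exact h ▸ le_max_right _ _
      · exact le_max_of_le_left (hB ⟨δ, ⟨hδ, Or.inl h1⟩, h2⟩)) ⟨γ.tgt + 1, Or.inl rfl⟩
  have hjm := hm.lt
  have : EdgeZ S γ.src m := by
    apply EdgeZ.of_nc hS (by omega)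
    intro s hs
    have h1 := (edge_of_mem hγ).nc' hS hs
    have h2 := hm.nc' hS hs
    have h4 : s.src = γ.tgt → s.tgt ≤ m := fun h => hmax _ (h ▸ edge_of_mem hs)
    have h5 := hcon s hs
    omega
  obtain ⟨δ, hδ, h1, h2⟩ := this.arc (by omega)
  have := hcon δ hδ
  omega

theorem upper_apex {S : Set ArcZ} (hS : IsTriangulationZ S) (hlf : LocallyFinZ S)
    {γ : ArcZ} (hγ : γ ∈ S) :
    (∃ v, v < γ.src ∧ EdgeZ S v γ.src ∧ EdgeZ S v γ.tgt) ∨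
    (∃ v, γ.tgt < v ∧ EdgeZ S γ.src v ∧ EdgeZ S γ.tgt v) := by
  have hsep := γ.sep
  let P : ℕ → Prop := fun n => ∃ δ ∈ S, δ.src ≤ γ.src ∧ γ.tgt ≤ δ.tgt ∧
    (δ.src < γ.src ∨ γ.tgt < δ.tgt) ∧ δ.tgt - δ.src = n
  have hP : ∃ n, P n := by
    obtain ⟨δ, hδ, h1, h2, h3⟩ := exists_over hS hlf hγ
    exact ⟨(δ.tgt - δ.src).toNat, δ, hδ, h1, h2, h3, by omega⟩
  obtain ⟨δ, hδ, h1, h2, h3, h4⟩ := Nat.find_spec hP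
  have hmin : ∀ s ∈ S, s.src ≤ γ.src → γ.tgt ≤ s.tgt → s.tgt - s.src < δ.tgt - δ.src →
      s.src = γ.src ∧ s.tgt = γ.tgt := by
    intro s hs h5 h6 h7
    by_contra hne
    have := Nat.find_min' hP (m := (s.tgt - s.src).toNat) ⟨s, hs, h5, h6, by omega, by omega⟩
    omega
  obtain ⟨k, hk1, hk2, e1, e2⟩ := lower_apex hS hδ
  have n1 := e1.nc' hS hγ
  have n2 := e2.nc' hS hγ
  have hk : k ≤ γ.src ∨ γ.tgt ≤ k := by omega
  rcases hk with hk | hk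
  · obtain ⟨s, hs, s1, s2⟩ := e2.arc (by omega)
    obtain ⟨q1, q2⟩ := hmin s hs (by omega) (by omega) (by omega)
    left
    refine ⟨δ.src, by omega, ?_, ?_⟩
    · rwa [← q1, s1]
    · rw [← q2, s2]; exact edge_of_mem hδ
  · obtain ⟨s, hs, s1, s2⟩ := e1.arc (by omega)
    obtain ⟨q1, q2⟩ := hmin s hs (by omega) (by omega) (by omega)
    right
    refine ⟨δ.tgt, by omega, ?_, ?_⟩
    · rw [← q1, s1]; exact edge_of_mem hδ
    · rwa [← q2, s2]

/-- `v` is the inner apex and `w` the outer apex of `γ` in `S`. -/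
def InApex (S : Set ArcZ) (γ : ArcZ) (v : ℤ) : Prop :=
  γ.src < v ∧ v < γ.tgt ∧ EdgeZ S γ.src v ∧ EdgeZ S v γ.tgt

/-- `w` is the outer apex of `γ` in `S`. -/
def OutApex (S : Set ArcZ) (γ : ArcZ) (w : ℤ) : Prop :=
  (w < γ.src ∧ EdgeZ S w γ.src ∧ EdgeZ S w γ.tgt) ∨
  (γ.tgt < w ∧ EdgeZ S γ.src w ∧ EdgeZ S γ.tgt w)

theorem ArcZ.ext' {x y : ArcZ} (h1 : x.src = y.src) (h2 : x.tgt = y.tgt) : x = y := by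
  cases x; cases y; simp_all

set_option maxHeartbeats 2000000 in
theorem flip_of_apex {S : Set ArcZ} (hS : IsTriangulationZ S) {γ φ : ArcZ} (hγ : γ ∈ S)
    {v w : ℤ} (hv : InApex S γ v) (hw : OutApex S γ w)
    (hφ : (φ.src = v ∧ φ.tgt = w) ∨ (φ.src = w ∧ φ.tgt = v)) :
    IsMutableZ S γ ∧ flipArcZ S γ = φ := by
  obtain ⟨v1, v2, e1, e2⟩ := hv
  have hsep := γ.sep
  have hsepφ := φ.sep
  have A : ∀ s ∈ S, CrossZ φ s → s = γ := by
    intro s hs hc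
    have n0 := (edge_of_mem hγ).nc' hS hs
    have n1 := e1.nc' hS hs
    have n2 := e2.nc' hS hs
    unfold CrossZ at hc
    rcases hw with ⟨w1, e3, e4⟩ | ⟨w1, e3, e4⟩
    · have n3 := e3.nc' hS hs
      have n4 := e4.nc' hS hs
      clear e1 e2 e3 e4
      rcases hc with hc | hc <;> rcases hφ with hφ | hφ <;> first | (exfalso; omega) | (apply ArcZ.ext' <;> omega)
    · have n3 := e3.nc' hS hs
      have n4 := e4.nc' hS hs
      clear e1 e2 e3 e4
      rcases hc with hc | hc <;> rcases hφ with hφ | hφ <;> first | (exfalso; omega) | (apply ArcZ.ext' <;> omega)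
  have B : ∀ χ : ArcZ, CrossZ χ γ → (∀ s ∈ S, s ≠ γ → ¬ CrossZ χ s) → χ = φ := by
    intro χ hc hn
    have hsepχ := χ.sep
    have n1 := e1.nc χ (fun s hs _ h => hn s hs (by rintro rfl; omega))
    have n2 := e2.nc χ (fun s hs h _ => hn s hs (by rintro rfl; omega))
    unfold CrossZ at hc
    rcases hw with ⟨w1, e3, e4⟩ | ⟨w1, e3, e4⟩
    · have n3 := e3.nc χ (fun s hs h _ => hn s hs (by rintro rfl; omega))
      have n4 := e4.nc χ (fun s hs h _ => hn s hs (by rintro rfl; omega))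
      clear e1 e2 e3 e4
      rcases hc with hc | hc <;> rcases hφ with hφ | hφ <;> first | (exfalso; omega) | (apply ArcZ.ext' <;> omega)
    · have n3 := e3.nc χ (fun s hs _ h => hn s hs (by rintro rfl; omega))
      have n4 := e4.nc χ (fun s hs _ h => hn s hs (by rintro rfl; omega))
      clear e1 e2 e3 e4
      rcases hc with hc | hc <;> rcases hφ with hφ | hφ <;> first | (exfalso; omega) | (apply ArcZ.ext' <;> omega)
  have hcr : CrossZ φ γ := by
    unfold CrossZ
    rcases hw with ⟨w1, e3, e4⟩ | ⟨w1, e3, e4⟩ <;> omega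
  have sym : ∀ x y : ArcZ, CrossZ x y → CrossZ y x := by
    intro x y h; unfold CrossZ at *; tauto
  have irr : ∀ x : ArcZ, ¬ CrossZ x x := by
    intro x h; unfold CrossZ at h; omega
  have hex : MutExchangeZ S γ φ := by
    refine ⟨?_, ?_, ?_⟩
    · rintro rfl; exact irr _ hcr
    · rintro x (⟨hx, hxg⟩ | rfl) y (⟨hy, hyg⟩ | rfl) hc
      · exact hS.1 x hx y hy hc
      · exact hxg (A x hx (sym _ _ hc))
      · exact hyg (A y hy hc)
      · exact irr _ hc
    · intro χ hχ
      by_cases hc : CrossZ χ γ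
      · exact Or.inr (B χ hc (fun s hs hne => hχ s (Or.inl ⟨hs, hne⟩)))
      · refine Or.inl ⟨hS.2 χ ?_, ?_⟩
        · intro s hs
          by_cases h : s = γ
          · rwa [h]
          · exact hχ s (Or.inl ⟨hs, h⟩)
        · rintro rfl
          exact hχ φ (Or.inr rfl) (sym _ _ hcr)
  have huniq : ∀ χ, MutExchangeZ S γ χ → χ = φ := by
    rintro χ ⟨hne, hn, hmax⟩
    apply B χ
    · by_contra hc
      have : γ ∈ S \ {γ} ∪ {χ} := by
        apply hmax
        rintro s (⟨hs, _⟩ | rfl)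
        · exact hS.1 γ hγ s hs
        · exact fun h => hc (sym _ _ h)
      rcases this with h | h
      · exact h.2 rfl
      · exact hne h.symm
    · intro s hs hsg
      exact hn χ (Or.inr rfl) s (Or.inl ⟨hs, hsg⟩)
  have hE : ∃ γ', MutExchangeZ S γ γ' := ⟨φ, hex⟩
  refine ⟨⟨hγ, hE⟩, ?_⟩
  unfold flipArcZ
  rw [dif_pos hE]
  exact huniq _ hE.choose_spec

theorem finite_cross {S : Set ArcZ} (hlf : LocallyFinZ S) (t : ArcZ) :
    {s | s ∈ S ∧ CrossZ s t}.Finite := by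
  apply ((Set.finite_Icc t.src t.tgt).biUnion (fun v _ => hlf v)).subset
  rintro s ⟨hs, hc⟩
  simp only [Set.mem_iUnion, Set.mem_Icc, Set.mem_ofPred_eq]
  unfold CrossZ at hc
  rcases hc with hc | hc
  · exact ⟨s.tgt, by omega, hs, Or.inr rfl⟩
  · exact ⟨s.src, by omega, hs, Or.inl rfl⟩

/-- An arc crossing `t` with minimal three-part lexicographic key. -/
theorem exists_lex_min {S : Set ArcZ} (hlf : LocallyFinZ S) {t d : ArcZ} (hd : d ∈ S)
    (hc : CrossZ d t) (f g h : ArcZ → ℤ) :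
    ∃ a ∈ S, CrossZ a t ∧ ∀ b ∈ S, CrossZ b t →
      f a < f b ∨ (f a = f b ∧ (g a < g b ∨ (g a = g b ∧ h a ≤ h b))) := by
  obtain ⟨a, ⟨ha1, ha2⟩, ha⟩ := Set.exists_min_image {s | s ∈ S ∧ CrossZ s t}
    (fun s => toLex (f s, toLex (g s, h s))) (finite_cross hlf t) ⟨d, hd, hc⟩
  refine ⟨a, ha1, ha2, fun b hb hbc => ?_⟩
  have := ha b ⟨hb, hbc⟩
  simpa [Prod.Lex.toLex_le_toLex] using this

theorem src_end {S : Set ArcZ} (hS : IsTriangulationZ S) (hlf : LocallyFinZ S) {t d : ArcZ}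
    (hd : d ∈ S) (hc : CrossZ d t) :
    ∃ a ∈ S, CrossZ a t ∧ ((a.src < t.src ∧ InApex S a t.src) ∨
      (t.src < a.src ∧ OutApex S a t.src)) := by
  obtain ⟨a, ha, hac, hmin⟩ := exists_lex_min hlf hd hc
    (fun a => if a.src < t.src then a.tgt else a.src)
    (fun a => if a.src < t.src then 0 else 1)
    (fun a => if a.src < t.src then - a.src else - a.tgt)
  refine ⟨a, ha, hac, ?_⟩
  simp only [CrossZ] at hac hmin
  have hsep := a.sep
  rcases hac with hac | hac
  · left
    refine ⟨hac.1, ?_⟩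
    obtain ⟨v, v1, v2, e1, e2⟩ := lower_apex hS ha
    have : v = t.src := by
      by_contra hne
      rcases lt_or_gt_of_ne hne with h | h
      · obtain ⟨b, hb, b1, b2⟩ := e2.arc (by omega)
        have := hmin b hb (by omega)
        split_ifs at this <;> omega
      · obtain ⟨b, hb, b1, b2⟩ := e1.arc (by omega)
        have := hmin b hb (by omega)
        split_ifs at this <;> omega
    subst this
    exact ⟨v1, v2, e1, e2⟩
  · right
    refine ⟨hac.1, ?_⟩
    have hup := upper_apex hS hlf ha
    rcases hup with ⟨v, v1, e1, e2⟩ | ⟨v, v1, e1, e2⟩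
    · have : v = t.src := by
        by_contra hne
        rcases lt_or_gt_of_ne hne with h | h
        · obtain ⟨b, hb, b1, b2⟩ := e1.arc (by omega)
          have := hmin b hb (by omega)
          split_ifs at this <;> omega
        · obtain ⟨b, hb, b1, b2⟩ := e2.arc (by omega)
          have := hmin b hb (by omega)
          split_ifs at this <;> omega
      subst this
      exact Or.inl ⟨v1, e1, e2⟩
    · exfalso
      obtain ⟨b, hb, b1, b2⟩ := e1.arc (by omega)
      have := hmin b hb (by omega)
      split_ifs at this <;> omega

theorem tgt_end {S : Set ArcZ} (hS : IsTriangulationZ S) (hlf : LocallyFinZ S) {t d : ArcZ}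
    (hd : d ∈ S) (hc : CrossZ d t) :
    ∃ a ∈ S, CrossZ a t ∧ ((a.src < t.src ∧ OutApex S a t.tgt) ∨
      (t.src < a.src ∧ InApex S a t.tgt)) := by
  obtain ⟨a, ha, hac, hmin⟩ := exists_lex_min hlf hd hc
    (fun a => if a.src < t.src then - a.tgt else - a.src)
    (fun a => if a.src < t.src then 1 else 0)
    (fun a => if a.src < t.src then a.src else a.tgt)
  refine ⟨a, ha, hac, ?_⟩
  simp only [CrossZ] at hac hmin
  have hsep := a.sep
  rcases hac with hac | hac
  · left
    refine ⟨hac.1, ?_⟩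
    have hup := upper_apex hS hlf ha
    rcases hup with ⟨v, v1, e1, e2⟩ | ⟨v, v1, e1, e2⟩
    · exfalso
      obtain ⟨b, hb, b1, b2⟩ := e2.arc (by omega)
      have := hmin b hb (by omega)
      split_ifs at this <;> omega
    · have : v = t.tgt := by
        by_contra hne
        rcases lt_or_gt_of_ne hne with h | h
        · obtain ⟨b, hb, b1, b2⟩ := e1.arc (by omega)
          have := hmin b hb (by omega)
          split_ifs at this <;> omega
        · obtain ⟨b, hb, b1, b2⟩ := e2.arc (by omega)
          have := hmin b hb (by omega)
          split_ifs at this <;> omega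
      subst this
      exact Or.inr ⟨v1, e1, e2⟩
  · right
    refine ⟨hac.1, ?_⟩
    obtain ⟨v, v1, v2, e1, e2⟩ := lower_apex hS ha
    have : v = t.tgt := by
      by_contra hne
      rcases lt_or_gt_of_ne hne with h | h
      · obtain ⟨b, hb, b1, b2⟩ := e2.arc (by omega)
        have := hmin b hb (by omega)
        split_ifs at this <;> omega
      · obtain ⟨b, hb, b1, b2⟩ := e1.arc (by omega)
        have := hmin b hb (by omega)
        split_ifs at this <;> omega
    subst this
    exact ⟨v1, v2, e1, e2⟩

theorem flip_in {S : Set ArcZ} (hS : IsTriangulationZ S) (hlf : LocallyFinZ S) {γ : ArcZ}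
    (hγ : γ ∈ S) {v : ℤ} (hv : InApex S γ v) :
    IsMutableZ S γ ∧ ((flipArcZ S γ).src = v ∨ (flipArcZ S γ).tgt = v) := by
  have hv' := hv
  obtain ⟨v1, v2, -, -⟩ := hv'
  rcases upper_apex hS hlf hγ with ⟨w, h⟩ | ⟨w, h⟩
  · have := flip_of_apex hS (φ := ⟨w, v, by omega⟩) hγ hv (Or.inl h) (Or.inr ⟨rfl, rfl⟩)
    exact ⟨this.1, by simp [this.2]⟩
  · have := flip_of_apex hS (φ := ⟨v, w, by omega⟩) hγ hv (Or.inr h) (Or.inl ⟨rfl, rfl⟩)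
    exact ⟨this.1, by simp [this.2]⟩

theorem flip_out {S : Set ArcZ} (hS : IsTriangulationZ S) {γ : ArcZ}
    (hγ : γ ∈ S) {w : ℤ} (hw : OutApex S γ w) :
    IsMutableZ S γ ∧ ((flipArcZ S γ).src = w ∨ (flipArcZ S γ).tgt = w) := by
  obtain ⟨v, hv⟩ := lower_apex hS hγ
  have hv' := hv
  obtain ⟨v1, v2, -, -⟩ := hv'
  rcases id hw with ⟨h, -⟩ | ⟨h, -⟩
  · have := flip_of_apex hS (φ := ⟨w, v, by omega⟩) hγ hv hw (Or.inr ⟨rfl, rfl⟩)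
    exact ⟨this.1, by simp [this.2]⟩
  · have := flip_of_apex hS (φ := ⟨v, w, by omega⟩) hγ hv hw (Or.inl ⟨rfl, rfl⟩)
    exact ⟨this.1, by simp [this.2]⟩

theorem key_step {S : Set ArcZ} (hS : IsTriangulationZ S) (hlf : LocallyFinZ S) {t d : ArcZ}
    (hd : d ∈ S) (hc : CrossZ d t) :
    (IsMutableZ S d ∧ flipArcZ S d = t) ∨
    ∃ a, a ≠ d ∧ CrossZ a t ∧ IsMutableZ S a ∧ ¬ CrossZ (flipArcZ S a) t := by
  have nc : ∀ x : ArcZ, (x.src = t.src ∨ x.tgt = t.src) ∨ (x.src = t.tgt ∨ x.tgt = t.tgt) →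
      ¬ CrossZ x t := by
    intro x hx h
    have := x.sep
    have := t.sep
    unfold CrossZ at h
    omega
  obtain ⟨a, ha, hac, h1⟩ := src_end hS hlf hd hc
  obtain ⟨b, hb, hbc, h2⟩ := tgt_end hS hlf hd hc
  by_cases had : a = d
  · by_cases hbd : b = d
    · left
      subst hbd
      subst had
      rcases h1 with ⟨h1, i1⟩ | ⟨h1, i1⟩
      · rcases h2 with ⟨h2, i2⟩ | ⟨h2, i2⟩
        · exact flip_of_apex hS ha i1 i2 (Or.inl ⟨rfl, rfl⟩)
        · omega
      · rcases h2 with ⟨h2, i2⟩ | ⟨h2, i2⟩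
        · omega
        · exact flip_of_apex hS ha i2 i1 (Or.inr ⟨rfl, rfl⟩)
    · right
      refine ⟨b, hbd, hbc, ?_⟩
      rcases h2 with ⟨h2, i2⟩ | ⟨h2, i2⟩
      · have := flip_out hS hb i2
        exact ⟨this.1, nc _ (Or.inr this.2)⟩
      · have := flip_in hS hlf hb i2
        exact ⟨this.1, nc _ (Or.inr this.2)⟩
  · right
    refine ⟨a, had, hac, ?_⟩
    rcases h1 with ⟨h2, i2⟩ | ⟨h2, i2⟩
    · have := flip_in hS hlf ha i2
      exact ⟨this.1, nc _ (Or.inl this.2)⟩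
    · have := flip_out hS ha i2
      exact ⟨this.1, nc _ (Or.inl this.2)⟩

theorem mutate_tri {S : Set ArcZ} {a : ArcZ} (h : IsMutableZ S a) :
    IsTriangulationZ (mutateZ S a) := by
  obtain ⟨_, hE⟩ := h
  unfold mutateZ flipArcZ
  rw [dif_pos hE]
  exact hE.choose_spec.2

theorem mutate_lf {S : Set ArcZ} (hlf : LocallyFinZ S) (a : ArcZ) :
    LocallyFinZ (mutateZ S a) := by
  intro v
  apply ((hlf v).union (Set.finite_singleton (flipArcZ S a))).subset
  rintro s ⟨⟨hs, _⟩ | hs, h⟩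
  · exact Or.inl ⟨hs, h⟩
  · exact Or.inr hs

theorem cross_decrease {S : Set ArcZ} (hlf : LocallyFinZ S) {a t : ArcZ} (ha : a ∈ S)
    (hc : CrossZ a t) (hn : ¬ CrossZ (flipArcZ S a) t) :
    {s | s ∈ mutateZ S a ∧ CrossZ s t}.ncard < {s | s ∈ S ∧ CrossZ s t}.ncard := by
  apply Set.ncard_lt_ncard _ (finite_cross hlf t)
  refine ⟨?_, fun h => ?_⟩
  · rintro s ⟨⟨hs, _⟩ | rfl, h⟩
    · exact ⟨hs, h⟩
    · exact absurd h hn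
  · rcases (h ⟨ha, hc⟩ : a ∈ mutateZ S a ∧ _).1 with h | h
    · exact h.2 rfl
    · rw [Set.mem_singleton_iff] at h
      rw [← h] at hn
      exact hn hc

/-- Abstract fair scheduler. -/
theorem scheduler {σ A : Type} (step : σ → Option A → σ) (hnone : ∀ s, step s none = s)
    (Inv : σ → Prop) (legal : σ → A → Prop) (D : ℕ → σ → Prop) (m : ℕ → σ → ℕ)
    (hInv : ∀ s a, Inv s → legal s a → Inv (step s (some a)))
    (hD : ∀ n s a, Inv s → legal s a → D n s → D n (step s (some a)))
    (hprog : ∀ n s, Inv s → ¬ D n s → ∃ a, legal s a ∧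
      (D n (step s (some a)) ∨ m n (step s (some a)) < m n s))
    (s0 : σ) (h0 : Inv s0) :
    ∃ (θ : ℕ → Option A) (st : ℕ → σ), st 0 = s0 ∧ (∀ k, st (k + 1) = step (st k) (θ k)) ∧
      (∀ k, Inv (st k)) ∧ (∀ k, θ k = none → θ (k + 1) = none) ∧
      (∀ k a, θ k = some a → legal (st k) a) ∧ (∀ n, ∃ K, ∀ k, K ≤ k → D n (st k)) := by
  have hnext : ∀ s, ∃ o : Option A, Inv s → ((∀ n, D n s) → o = none) ∧
      (∀ n, ¬ D n s → (∀ j < n, D j s) → ∃ a, o = some a ∧ legal s a ∧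
        (D n (step s (some a)) ∨ m n (step s (some a)) < m n s)) := by
    intro s
    by_cases hs : Inv s
    · by_cases h : ∃ n, ¬ D n s
      · obtain ⟨a, ha⟩ := hprog _ s hs (Nat.find_spec h)
        refine ⟨some a, fun _ => ⟨fun h' => absurd (h' _) (Nat.find_spec h), ?_⟩⟩
        intro n hn hj
        have : n = Nat.find h := by
          apply le_antisymm
          · by_contra hlt
            exact Nat.find_spec h (hj _ (by omega))
          · exact Nat.find_min' h hn
        subst this
        exact ⟨a, rfl, ha⟩
      · push Not at h
        exact ⟨none, fun _ => ⟨fun _ => rfl, fun n hn => absurd (h n) hn⟩⟩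
    · exact ⟨none, fun h => absurd h hs⟩
  choose next hnx using hnext
  let st : ℕ → σ := fun k => Nat.rec s0 (fun _ s => step s (next s)) k
  have hst : ∀ k, st (k + 1) = step (st k) (next (st k)) := fun k => rfl
  have hleg : ∀ s, Inv s → ∀ a, next s = some a → legal s a := by
    intro s hs a ha
    obtain ⟨q1, q2⟩ := hnx s hs
    by_cases h : ∃ n, ¬ D n s
    · obtain ⟨b, hb, hl, -⟩ := q2 _ (Nat.find_spec h)
        (fun j hj => not_not.1 (Nat.find_min h hj))
      rw [ha] at hb
      cases hb
      exact hl
    · push Not at h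
      rw [q1 h] at ha
      cases ha
  have hI : ∀ k, Inv (st k) := by
    intro k
    induction k with
    | zero => exact h0
    | succ k ih =>
      rw [hst]
      cases h : next (st k) with
      | none => rw [hnone]; exact ih
      | some a => exact hInv _ _ ih (hleg _ ih _ h)
  have hD1 : ∀ n k, D n (st k) → D n (st (k + 1)) := by
    intro n k hk
    rw [hst]
    cases h : next (st k) with
    | none => rw [hnone]; exact hk
    | some a => exact hD _ _ _ (hI k) (hleg _ (hI k) _ h) hk
  have hD2 : ∀ n k l, k ≤ l → D n (st k) → D n (st l) := by
    intro n k l hkl hk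
    induction l, hkl using Nat.le_induction with
    | base => exact hk
    | succ l _ ih => exact hD1 _ _ ih
  have hreach : ∀ n, ∃ K, ∀ j < n, D j (st K) := by
    intro n
    induction n with
    | zero => exact ⟨0, fun j hj => absurd hj (Nat.not_lt_zero j)⟩
    | succ n ih =>
      obtain ⟨K, hK⟩ := ih
      have : ∀ c k, K ≤ k → m n (st k) ≤ c → ∃ K', k ≤ K' ∧ D n (st K') := by
        intro c
        induction c with
        | zero =>
          intro k hk hm
          by_cases hd : D n (st k)
          · exact ⟨k, le_rfl, hd⟩
          obtain ⟨a, ha, _, h | h⟩ := (hnx _ (hI k)).2 n hd (fun j hj => hD2 _ _ _ hk (hK j hj))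
          · exact ⟨k + 1, by omega, by rw [hst, ha]; exact h⟩
          · omega
        | succ c ihc =>
          intro k hk hm
          by_cases hd : D n (st k)
          · exact ⟨k, le_rfl, hd⟩
          obtain ⟨a, ha, _, h | h⟩ := (hnx _ (hI k)).2 n hd (fun j hj => hD2 _ _ _ hk (hK j hj))
          · exact ⟨k + 1, by omega, by rw [hst, ha]; exact h⟩
          · obtain ⟨K', h1, h2⟩ := ihc (k + 1) (by omega) (by rw [hst, ha]; omega)
            exact ⟨K', by omega, h2⟩
      obtain ⟨K', h1, h2⟩ := this _ K le_rfl le_rfl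
      refine ⟨K', fun j hj => ?_⟩
      rcases Nat.lt_succ_iff_lt_or_eq.1 hj with h | rfl
      · exact hD2 _ _ _ h1 (hK j h)
      · exact h2
  refine ⟨fun k => next (st k), st, rfl, hst, hI, ?_, ?_, ?_⟩
  · intro k hk
    have : st (k + 1) = st k := by
      rw [hst]
      simp only at hk
      rw [hk, hnone]
    simp only [this]
    exact hk
  · intro k a ha
    exact hleg _ (hI k) _ ha
  · intro n
    obtain ⟨K, hK⟩ := hreach (n + 1)
    exact ⟨K, fun k hk => hD2 _ _ _ hk (hK n (by omega))⟩

theorem arc_enum : ∃ e : ℕ → ArcZ ⊕ ArcZ, Function.Surjective e := by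
  have : Countable ArcZ := by
    have hinj : Function.Injective (fun a : ArcZ => (a.src, a.tgt)) := by
      intro a b h
      simp only [Prod.mk.injEq] at h
      exact ArcZ.ext' h.1 h.2
    exact hinj.countable
  have : Nonempty (ArcZ ⊕ ArcZ) := ⟨Sum.inl ⟨0, 2, by norm_num⟩⟩
  exact exists_surjective_nat _

/-- Any two locally finite triangulations of the ∞-gon are connected by mutation along an
admissible sequence. -/
theorem statement12 (T T' : Set ArcZ) (hT : IsTriangulationZ T) (hT' : IsTriangulationZ T')
    (hlf : LocallyFinZ T) (hlf' : LocallyFinZ T') :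
    ∃ θ : ℕ → Option ArcZ, AdmissibleZ T θ ∧ mutSeqZ T θ = T' := by
  have sym : ∀ x y : ArcZ, CrossZ x y → CrossZ y x := by
    intro x y h; unfold CrossZ at *; tauto
  obtain ⟨e, he⟩ := arc_enum
  have hch : ∀ d : ArcZ, ∃ t, d ∉ T' → t ∈ T' ∧ CrossZ d t := by
    intro d
    by_cases h : d ∈ T'
    · exact ⟨d, fun h' => absurd h h'⟩
    · by_contra! hcon
      exact h (hT'.2 d (fun x hx hc => (hcon x).2 hx hc))
  choose c hcT using hch
  let D0 : ArcZ ⊕ ArcZ → Set ArcZ × (ArcZ → ArcZ) → Prop := fun x s =>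
    match x with
    | Sum.inl γ => γ ∈ T → s.2 γ ∈ T'
    | Sum.inr t => t ∈ T' → t ∈ s.1
  let m0 : ArcZ ⊕ ArcZ → Set ArcZ × (ArcZ → ArcZ) → ℕ := fun x s =>
    match x with
    | Sum.inl γ => {u | u ∈ s.1 ∧ CrossZ u (c (s.2 γ))}.ncard
    | Sum.inr t => {u | u ∈ s.1 ∧ CrossZ u t}.ncard
  obtain ⟨θ, st, hst0, hst, hInv, hnone, hlegal, hdone⟩ := scheduler
    (σ := Set ArcZ × (ArcZ → ArcZ)) (A := ArcZ)
    (fun s o => (stepTZ s.1 o, fun γ => stepAZ s.1 o (s.2 γ)))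
    (fun s => rfl)
    (fun s => IsTriangulationZ s.1 ∧ LocallyFinZ s.1 ∧ s.2 '' T = s.1)
    (fun s a => IsMutableZ s.1 a ∧ a ∉ T')
    (fun n => D0 (e n)) (fun n => m0 (e n))
    (by
      rintro ⟨S, f⟩ a ⟨h1, h2, h3⟩ ⟨h4, h5⟩
      refine ⟨mutate_tri h4, mutate_lf h2 a, ?_⟩
      simp only at h1 h2 h3 h4
      simp only [stepTZ, stepAZ, mutArcZ, mutateZ]
      ext x
      constructor
      · rintro ⟨γ, hγ, rfl⟩
        simp only
        split_ifs with h
        · exact Or.inr rfl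
        · exact Or.inl ⟨h3 ▸ ⟨γ, hγ, rfl⟩, h⟩
      · rintro (⟨hx, hxa⟩ | rfl)
        · rw [← h3] at hx
          obtain ⟨γ, hγ, rfl⟩ := hx
          exact ⟨γ, hγ, if_neg hxa⟩
        · have := h4.1
          rw [← h3] at this
          obtain ⟨γ, hγ, hh⟩ := this
          exact ⟨γ, hγ, if_pos hh⟩)
    (by
      rintro n ⟨S, f⟩ a ⟨h1, h2, h3⟩ ⟨h4, h5⟩ hd
      simp only at h1 h2 h3 h4 hd ⊢
      cases hx : e n with
      | inl γ =>
        rw [hx] at hd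
        simp only [D0, stepAZ, mutArcZ] at hd ⊢
        intro hγ
        rw [if_neg (fun h : f γ = a => h5 (h ▸ hd hγ))]
        exact hd hγ
      | inr t =>
        rw [hx] at hd
        simp only [D0, stepTZ, mutateZ] at hd ⊢
        intro ht
        exact Or.inl ⟨hd ht, fun h => h5 (h ▸ ht)⟩)
    (by
      rintro n ⟨S, f⟩ ⟨h1, h2, h3⟩ hd
      simp only at h1 h2 h3 hd ⊢
      cases hx : e n with
      | inl γ =>
        rw [hx] at hd
        simp only [D0, m0, stepAZ, stepTZ, mutArcZ] at hd ⊢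
        push Not at hd
        obtain ⟨hγ, hfd⟩ := hd
        obtain ⟨ht, hc⟩ := hcT _ hfd
        have hfS : f γ ∈ S := h3 ▸ ⟨γ, hγ, rfl⟩
        rcases key_step h1 h2 hfS hc with ⟨k1, k2⟩ | ⟨a, k1, k2, k3, k4⟩
        · exact ⟨f γ, ⟨k1, hfd⟩, Or.inl (fun _ => by rw [if_pos rfl, k2]; exact ht)⟩
        · refine ⟨a, ⟨k3, fun h => hT'.1 a h _ ht k2⟩, Or.inr ?_⟩
          rw [if_neg (Ne.symm k1)]
          exact cross_decrease h2 k3.1 k2 k4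
      | inr t =>
        rw [hx] at hd
        simp only [D0, m0, stepTZ] at hd ⊢
        push Not at hd
        obtain ⟨ht, htS⟩ := hd
        have : ∃ d ∈ S, CrossZ d t := by
          by_contra! hcon
          exact htS (h1.2 t (fun x hx hc => hcon x hx (sym _ _ hc)))
        obtain ⟨d, hdS, hc⟩ := this
        rcases key_step h1 h2 hdS hc with ⟨k1, k2⟩ | ⟨a, k1, k2, k3, k4⟩
        · exact ⟨d, ⟨k1, fun h => hT'.1 d h _ ht hc⟩, Or.inl (fun _ => Or.inr k2.symm)⟩
        · exact ⟨a, ⟨k3, fun h => hT'.1 a h _ ht k2⟩, Or.inr (cross_decrease h2 k3.1 k2 k4)⟩)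
    (T, id) ⟨hT, hlf, by simp⟩
  have hiT : ∀ k, iterTZ T θ k = (st k).1 := by
    intro k
    induction k with
    | zero => rw [hst0]; rfl
    | succ k ih => rw [hst]; simp only [iterTZ, ih]
  have hiA : ∀ γ k, iterAZ T θ γ k = (st k).2 γ := by
    intro γ k
    induction k with
    | zero => rw [hst0]; rfl
    | succ k ih => rw [hst]; simp only [iterAZ, ih, hiT]
  have hfix : ∀ γ k l, k ≤ l → (st k).2 γ ∈ T' → (st l).2 γ = (st k).2 γ := by
    intro γ k l hkl hk
    induction l, hkl using Nat.le_induction with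
    | base => rfl
    | succ l _ ih =>
      rw [hst]
      cases h : θ l with
      | none => exact ih
      | some a =>
        have := (hlegal l a h).2
        simp only [stepAZ, mutArcZ, ih]
        rw [if_neg (fun hh : (st _).2 γ = a => this (hh ▸ hk))]
  have hin : ∀ γ ∈ T, ∃ K, (st K).2 γ ∈ T' := by
    intro γ hγ
    obtain ⟨n, hn⟩ := he (Sum.inl γ)
    obtain ⟨K, hK⟩ := hdone n
    have := hK K le_rfl
    simp only [hn, D0] at this
    exact ⟨K, this hγ⟩
  have hstab : ∀ γ K, (st K).2 γ ∈ T' → ∀ k, K ≤ k → iterAZ T θ γ k = iterAZ T θ γ K := by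
    intro γ K hK k hk
    rw [hiA, hiA]
    exact hfix _ _ _ hk hK
  have hlim : ∀ γ K, (st K).2 γ ∈ T' → seqLimitZ T θ γ = (st K).2 γ := by
    intro γ K hK
    have hE : ∃ l, ∀ k, l ≤ k → iterAZ T θ γ k = iterAZ T θ γ l := ⟨K, hstab γ K hK⟩
    unfold seqLimitZ
    rw [dif_pos hE, ← hiA]
    have h1 := hE.choose_spec (max K hE.choose) (le_max_right _ _)
    have h2 := hstab γ K hK (max K hE.choose) (le_max_left _ _)
    rw [← h1, h2]
  refine ⟨θ, ⟨hnone, ?_, ?_⟩, ?_⟩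
  · intro i γ h
    rw [hiT]
    exact (hlegal i γ h).1
  · intro γ hγ
    obtain ⟨K, hK⟩ := hin γ hγ
    exact ⟨K, hstab γ K hK⟩
  · ext t
    constructor
    · rintro ⟨γ, hγ, rfl⟩
      obtain ⟨K, hK⟩ := hin γ hγ
      rw [hlim γ K hK]
      exact hK
    · intro ht
      obtain ⟨n, hn⟩ := he (Sum.inr t)
      obtain ⟨K, hK⟩ := hdone n
      have := hK K le_rfl
      simp only [hn, D0] at this
      have hS := this ht
      rw [← (hInv K).2.2] at hS
      obtain ⟨γ, hγ, hh⟩ := hS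
      exact ⟨γ, hγ, by rw [hlim γ K (hh ▸ ht), hh]⟩
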